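/- Let n = 1 + m₁ + m₂ and let A ∈ ℝ^{n×n} be the symmetric matrix with block structure A = [[0, A₁₂, 0],[A₂₁, 0, A₂₃],[0, A₃₂, 0]], where A₂₁ = A₁₂ᵀ ∈ ℝ^{m₁} has no zero entries and A₃₂ = A₂₃ᵀ ∈ ℝ^{m₂×m₁} is such that every row of A₃₂ has exactly one nonzero entry (so G(A) is a tree in which every follower has distance at most 2 from the leader 1). Then the pair (A, e₁) is herdable if and only if for every pair i, j ∈ [1,m₁] (including i = j) satisfying Σ_{k=1}^{m₂} ([A₃₂]_{ki})² = Σ_{k=1}^{m₂} ([A₃₂]_{kj})², both of the following hold: (i) [A₂₁]_i · [A₂₁]_j > 0; (ii) the vector A₃₂(e_i + e_j) is either zero or unisigned. -/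

import Mathlib

open Matrix

/-- A nonzero real vector is unisigned if all its nonzero entries have the same sign. -/
def Unisigned {ι : Type*} (v : ι → ℝ) : Prop :=
  v ≠ 0 ∧ ((∀ i, 0 ≤ v i) ∨ (∀ i, v i ≤ 0))

/-- The state indices: the leader, then the followers at distance 1 (F₁), then the
followers at distance 2 (F₂); the total dimension is n = 1 + m₁ + m₂. -/
abbrev TreeIdx (m₁ m₂ : ℕ) := Unit ⊕ Fin m₁ ⊕ Fin m₂

/-- The controllability matrix `[b | Ab | ... | A^{n-1}b]` for a single-input pair `(A, b)`. -/
def ctrbMat {I : Type*} [Fintype I] [DecidableEq I] (A : Matrix I I ℝ) (b : I → ℝ) :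
    Matrix I (Fin (Fintype.card I)) ℝ :=
  Matrix.of fun i k => (A ^ (k : ℕ)).mulVec b i

/-! ### The reachable space of a single-input pair -/

section Krylov

variable {I : Type*} [Fintype I] [DecidableEq I] (A : Matrix I I ℝ) (b : I → ℝ)

theorem ctrbMat_mulVec (u : Fin (Fintype.card I) → ℝ) :
    ctrbMat A b *ᵥ u = ∑ k, u k • (A ^ (k : ℕ) *ᵥ b) := by
  ext r
  simp [ctrbMat, Matrix.mulVec, dotProduct, Finset.sum_apply, mul_comm]

theorem aeval_mulVec_mem_range_ctrbMat (p : Polynomial ℝ) :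
    Polynomial.aeval A p *ᵥ b ∈ LinearMap.range (ctrbMat A b).mulVecLin := by
  rcases isEmpty_or_nonempty I with hI | hI
  · exact ⟨0, Subsingleton.elim _ _⟩
  have hdeg : (p %ₘ A.charpoly).natDegree < Fintype.card I := by
    rw [← Matrix.charpoly_natDegree_eq_dim A]
    refine Polynomial.natDegree_modByMonic_lt _ (Matrix.charpoly_monic A) fun h => ?_
    have := Matrix.charpoly_natDegree_eq_dim A
    rw [h, Polynomial.natDegree_one] at this
    exact Fintype.card_ne_zero this.symm
  refine ⟨fun k => (p %ₘ A.charpoly).coeff k, ?_⟩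
  rw [Matrix.mulVecLin_apply, ctrbMat_mulVec, Matrix.aeval_eq_aeval_mod_charpoly,
    Polynomial.aeval_eq_sum_range' hdeg, Matrix.sum_mulVec, Finset.sum_range]
  simp [Matrix.smul_mulVec]

theorem self_mem_range_ctrbMat : b ∈ LinearMap.range (ctrbMat A b).mulVecLin := by
  simpa using aeval_mulVec_mem_range_ctrbMat A b 1

theorem mulVec_mem_range_ctrbMat {v : I → ℝ}
    (hv : v ∈ LinearMap.range (ctrbMat A b).mulVecLin) :
    A *ᵥ v ∈ LinearMap.range (ctrbMat A b).mulVecLin := by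
  obtain ⟨u, rfl⟩ := hv
  rw [Matrix.mulVecLin_apply, ctrbMat_mulVec, Matrix.mulVec_sum]
  refine Submodule.sum_mem _ fun k _ => ?_
  rw [Matrix.mulVec_smul, Matrix.mulVec_mulVec, ← pow_succ']
  refine Submodule.smul_mem _ _ ?_
  simpa using aeval_mulVec_mem_range_ctrbMat A b (Polynomial.X ^ ((k : ℕ) + 1))

theorem range_ctrbMat_le {K : Submodule ℝ (I → ℝ)} (hb : b ∈ K)
    (hK : ∀ v ∈ K, A *ᵥ v ∈ K) : LinearMap.range (ctrbMat A b).mulVecLin ≤ K := by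
  rintro _ ⟨u, rfl⟩
  rw [Matrix.mulVecLin_apply, ctrbMat_mulVec]
  refine Submodule.sum_mem _ fun k _ => Submodule.smul_mem _ _ ?_
  induction (k : ℕ) with
  | zero => simpa using hb
  | succ n ih => rw [pow_succ', ← Matrix.mulVec_mulVec]; exact hK _ ih

end Krylov

/-! ### The reachable space of a tree of depth two -/

section Tree

variable {m₁ m₂ : ℕ}

/-- The vector of `ℝⁿ` with the given leader, distance 1 and distance 2 components. -/
def treeVec (x : ℝ) (y : Fin m₁ → ℝ) (z : Fin m₂ → ℝ) : TreeIdx m₁ m₂ → ℝ :=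
  Sum.elim (fun _ => x) (Sum.elim y z)

theorem treeVec_add (x x' : ℝ) (y y' : Fin m₁ → ℝ) (z z' : Fin m₂ → ℝ) :
    treeVec x y z + treeVec x' y' z' = treeVec (x + x') (y + y') (z + z') := by
  ext (_ | _ | _) <;> rfl

theorem smul_treeVec (a x : ℝ) (y : Fin m₁ → ℝ) (z : Fin m₂ → ℝ) :
    a • treeVec x y z = treeVec (a * x) (a • y) (a • z) := by
  ext (_ | _ | _) <;> rfl

theorem single_leader_eq_treeVec :
    (Pi.single (Sum.inl ()) 1 : TreeIdx m₁ m₂ → ℝ) = treeVec 1 0 0 := by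
  ext (_ | _ | _) <;> simp [treeVec]

/-- The vectors with free leader component, in which the follower `i` at distance 1 carries
`p (s i) * c i` and the follower `k` at distance 2 carries `q (s (par k)) * (w k * c (par k))`,
for arbitrary functions `p` and `q`. -/
def treeSpace (c s : Fin m₁ → ℝ) (par : Fin m₂ → Fin m₁) (w : Fin m₂ → ℝ) :
    Submodule ℝ (TreeIdx m₁ m₂ → ℝ) where
  carrier := {v | ∃ (x : ℝ) (p q : ℝ → ℝ), v = treeVec x (fun i => p (s i) * c i)
    (fun k => q (s (par k)) * (w k * c (par k)))}
  add_mem' := by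
    rintro _ _ ⟨x, p, q, rfl⟩ ⟨x', p', q', rfl⟩
    refine ⟨x + x', p + p', q + q', ?_⟩
    rw [treeVec_add]
    congr 1 <;> ext <;> simp <;> ring
  zero_mem' := ⟨0, 0, 0, by ext (_ | _ | _) <;> simp [treeVec]⟩
  smul_mem' := by
    rintro a _ ⟨x, p, q, rfl⟩
    refine ⟨a * x, a • p, a • q, ?_⟩
    rw [smul_treeVec]
    congr 1 <;> ext <;> simp <;> ring

variable {c s : Fin m₁ → ℝ} {par : Fin m₂ → Fin m₁} {w : Fin m₂ → ℝ}
  {A : Matrix (TreeIdx m₁ m₂) (TreeIdx m₁ m₂) ℝ}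

theorem range_ctrbMat_eq_treeSpace
    (hs : ∀ i, s i = ∑ k, if i = par k then w k ^ 2 else 0)
    (hA : ∀ x y z, A *ᵥ treeVec x y z = treeVec (∑ i, c i * y i)
      (fun i => c i * x + ∑ k, if i = par k then w k * z k else 0)
      (fun k => w k * y (par k))) :
    LinearMap.range (ctrbMat A (Pi.single (Sum.inl ()) 1)).mulVecLin =
      treeSpace c s par w := by
  have hz : ∀ (q : ℝ → ℝ) i, (∑ k, if i = par k then
      w k * (q (s (par k)) * (w k * c (par k))) else 0) = s i * q (s i) * c i := by
    intro q i
    rw [hs i, Finset.sum_mul, Finset.sum_mul, ← hs i]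
    refine Finset.sum_congr rfl fun k _ => ?_
    split_ifs with h
    · subst h; ring
    · ring
  apply le_antisymm
  · refine range_ctrbMat_le _ _ ⟨1, 0, 0, ?_⟩ ?_
    · rw [single_leader_eq_treeVec]
      ext (_ | _ | _) <;> simp [treeVec]
    · rintro _ ⟨x, p, q, rfl⟩
      refine ⟨∑ i, c i * (p (s i) * c i), fun t => x + t * q t, p, ?_⟩
      rw [hA]
      congr 1
      · ext i
        rw [hz]; ring
      · ext k; ring
  · set K := LinearMap.range (ctrbMat A (Pi.single (Sum.inl ()) 1)).mulVecLin
    have hone : treeVec 1 0 0 ∈ K :=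
      single_leader_eq_treeVec (m₁ := m₁) (m₂ := m₂) ▸ self_mem_range_ctrbMat A _
    have hlead : ∀ x, treeVec x 0 0 ∈ K := fun x => by
      simpa [smul_treeVec] using K.smul_mem x hone
    have hdown : ∀ y, treeVec 0 y 0 ∈ K → treeVec 0 0 (fun k => w k * y (par k)) ∈ K := by
      intro y hy
      have h := K.add_mem (mulVec_mem_range_ctrbMat A _ hy) (hlead (-∑ i, c i * y i))
      rw [hA, treeVec_add] at h
      convert h using 2
      · simp
      · ext; simp
      · ext; simp
    have hup : ∀ z, treeVec 0 0 z ∈ K →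
        treeVec 0 (fun i => ∑ k, if i = par k then w k * z k else 0) 0 ∈ K := by
      intro z hz
      have h := mulVec_mem_range_ctrbMat A _ hz
      rw [hA] at h
      convert h using 2
      · simp
      · ext; simp
      · ext; simp
    have hpow : ∀ n : ℕ, treeVec 0 (fun i => s i ^ n * c i) 0 ∈ K := by
      intro n
      induction n with
      | zero =>
        have h := mulVec_mem_range_ctrbMat A _ hone
        rw [hA] at h
        convert h using 2
        · simp
        · ext; simp
        · ext; simp
      | succ n ih =>
        convert hup _ (hdown _ ih) using 2
        ext i
        rw [pow_succ', ← hz (fun t => t ^ n)]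
        refine Finset.sum_congr rfl fun k _ => ?_
        split_ifs <;> ring
    have hpoly : ∀ f : Polynomial ℝ, treeVec 0 (fun i => f.eval (s i) * c i) 0 ∈ K := by
      intro f
      induction f using Polynomial.induction_on' with
      | add f g hf hg =>
        convert K.add_mem hf hg using 1
        rw [treeVec_add]
        congr 1
        · simp
        · ext; simp [add_mul]
        · simp
      | monomial n a =>
        convert K.smul_mem a (hpow n) using 1
        rw [smul_treeVec]
        congr 1
        · simp
        · ext; simp [mul_assoc]
        · simp
    have hfun : ∀ p : ℝ → ℝ, treeVec 0 (fun i => p (s i) * c i) 0 ∈ K := by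
      intro p
      convert hpoly (Lagrange.interpolate (Finset.univ.image s) id p) using 4 with i
      exact (Lagrange.eval_interpolate_at_node (v := id) p (Function.injective_id.injOn)
        (Finset.mem_image_of_mem s (Finset.mem_univ i))).symm
    rintro _ ⟨x, p, q, rfl⟩
    convert K.add_mem (K.add_mem (hlead x) (hfun p)) (hdown _ (hfun q)) using 1
    rw [treeVec_add, treeVec_add]
    congr 1
    · simp
    · ext; simp
    · ext; simp; ring

end Tree

theorem mul_pos_of_mul_pos_left {a b g : ℝ} (ha : 0 < g * a) (hb : 0 < g * b) : 0 < a * b := by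
  have h : 0 < g ^ 2 * (a * b) := by
    have := mul_pos ha hb
    linarith
  exact pos_of_mul_pos_right h (sq_nonneg g)

theorem exists_fun_mul_pos_iff {ι : Type*} (s a : ι → ℝ) :
    (∃ g : ℝ → ℝ, ∀ i, 0 < g (s i) * a i) ↔ ∀ i j, s i = s j → 0 < a i * a j := by
  classical
  constructor
  · rintro ⟨g, hg⟩ i j hij
    exact mul_pos_of_mul_pos_left (hg i) (hij ▸ hg j)
  · intro h
    refine ⟨fun t => if ht : ∃ i, s i = t then a ht.choose else 0, fun i => ?_⟩
    have hi : ∃ j, s j = s i := ⟨i, rfl⟩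
    simp only [hi, dif_pos]
    exact h _ _ hi.choose_spec

theorem eq_zero_or_unisigned_iff {ι : Type*} (v : ι → ℝ) :
    v = 0 ∨ Unisigned v ↔ ∀ k l, 0 ≤ v k * v l := by
  constructor
  · rintro (rfl | ⟨-, h | h⟩) k l
    · simp
    · exact mul_nonneg (h k) (h l)
    · exact mul_nonneg_of_nonpos_of_nonpos (h k) (h l)
  · intro h
    refine or_iff_not_imp_left.2 fun hv => ⟨hv, ?_⟩
    obtain ⟨l, hl⟩ := Function.ne_iff.1 hv
    rcases lt_or_gt_of_ne hl with hl | hl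
    · exact Or.inr fun k => nonpos_of_mul_nonneg_left (h k l) hl
    · exact Or.inl fun k => nonneg_of_mul_nonneg_left (h k l) hl

theorem herdable_conditions_iff {ι κ : Type*} [DecidableEq ι] {c s : ι → ℝ} {par : κ → ι}
    {w : κ → ℝ} (hw : ∀ k, w k ≠ 0) :
    ((∀ i j, s i = s j → 0 < c i * c j) ∧
      (∀ k l, s (par k) = s (par l) → 0 < w k * c (par k) * (w l * c (par l)))) ↔
    ∀ i j, s i = s j → 0 < c i * c j ∧ ∀ k l,
      0 ≤ ((if i = par k then w k else 0) + (if j = par k then w k else 0)) *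
        ((if i = par l then w l else 0) + (if j = par l then w l else 0)) := by
  have hrw : ∀ k l, w k * c (par k) * (w l * c (par l)) =
      c (par k) * c (par l) * (w k * w l) := fun k l => by ring
  constructor
  · rintro ⟨hc, hcw⟩ i j hij
    refine ⟨hc i j hij, fun k l => ?_⟩
    have hpos : s (par k) = s (par l) → 0 < w k * w l := fun h => by
      have := hcw k l h
      rw [hrw] at this
      exact pos_of_mul_pos_right this (hc _ _ h).le
    split_ifs <;> try simp
    all_goals
      have := hpos (by simp_all)
      nlinarith
  · intro h
    refine ⟨fun i j hij => (h i j hij).1, fun k l hkl => ?_⟩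
    obtain ⟨hc, hkl⟩ := h _ _ hkl
    rw [hrw]
    refine mul_pos hc (lt_of_le_of_ne ?_ (mul_ne_zero (hw k) (hw l)).symm)
    have := hkl k l
    by_cases hp : par k = par l
    · simp only [hp, if_true] at this
      nlinarith
    · simpa [hp, Ne.symm hp] using this

theorem stmt14 {m₁ m₂ : ℕ}
    (A₂₁ : Fin m₁ → ℝ) (A₃₂ : Matrix (Fin m₂) (Fin m₁) ℝ)
    -- A₂₁ = A₁₂ᵀ has no zero entries
    (h21 : ∀ i, A₂₁ i ≠ 0)
    -- every row of A₃₂ = A₂₃ᵀ has exactly one nonzero entry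
    (h32 : ∀ k : Fin m₂, ∃! i, A₃₂ k i ≠ 0)
    -- A is the symmetric matrix with block structure [[0,A₁₂,0],[A₂₁,0,A₂₃],[0,A₃₂,0]]
    (A : Matrix (TreeIdx m₁ m₂) (TreeIdx m₁ m₂) ℝ)
    (hA₀₀ : A (Sum.inl ()) (Sum.inl ()) = 0)
    (hA₁₂ : ∀ i, A (Sum.inl ()) (Sum.inr (Sum.inl i)) = A₂₁ i)
    (hA₂₁ : ∀ i, A (Sum.inr (Sum.inl i)) (Sum.inl ()) = A₂₁ i)
    (hA₂₃ : ∀ i k, A (Sum.inr (Sum.inl i)) (Sum.inr (Sum.inr k)) = A₃₂ k i)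
    (hA₃₂ : ∀ i k, A (Sum.inr (Sum.inr k)) (Sum.inr (Sum.inl i)) = A₃₂ k i)
    (hA₁₃ : ∀ k, A (Sum.inl ()) (Sum.inr (Sum.inr k)) = 0)
    (hA₃₁ : ∀ k, A (Sum.inr (Sum.inr k)) (Sum.inl ()) = 0)
    (hA₂₂ : ∀ i i', A (Sum.inr (Sum.inl i)) (Sum.inr (Sum.inl i')) = 0)
    (hA₃₃ : ∀ k k', A (Sum.inr (Sum.inr k)) (Sum.inr (Sum.inr k')) = 0) :
    -- (A, e₁) is herdable iff for every pair i, j in F₁ with equal sums of squared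
    -- weights towards F₂, conditions (i) and (ii) hold
    ((∃ u, ∀ r, 0 < (ctrbMat A (Pi.single (Sum.inl ()) 1)).mulVec u r) ↔
      (∀ i j : Fin m₁,
        (∑ k, (A₃₂ k i) ^ 2 = ∑ k, (A₃₂ k j) ^ 2) →
          (0 < A₂₁ i * A₂₁ j ∧
           ((fun k => A₃₂ k i + A₃₂ k j) = 0 ∨ Unisigned (fun k => A₃₂ k i + A₃₂ k j))))) := by
  choose par hpar huniq using h32
  obtain ⟨w, hw⟩ : ∃ w : Fin m₂ → ℝ, ∀ k, w k = A₃₂ k (par k) := ⟨_, fun _ => rfl⟩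
  have hw0 : ∀ k, w k ≠ 0 := fun k => hw k ▸ hpar k
  have hA : ∀ k i, A₃₂ k i = if i = par k then w k else 0 := by
    intro k i
    split_ifs with h
    · rw [h, hw]
    · exact not_not.1 fun hne => h (huniq k i hne)
  set s : Fin m₁ → ℝ := fun i => ∑ k, A₃₂ k i ^ 2
  have hs : ∀ i, s i = ∑ k, if i = par k then w k ^ 2 else 0 := fun i => by
    simp [s, hA, ite_pow]
  have hmul : ∀ x y z, A *ᵥ treeVec x y z = treeVec (∑ i, A₂₁ i * y i)
      (fun i => A₂₁ i * x + ∑ k, if i = par k then w k * z k else 0)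
      (fun k => w k * y (par k)) := by
    intro x y z
    ext (_ | i | k) <;>
      simp [Matrix.mulVec, dotProduct, treeVec, hA₀₀, hA₁₂, hA₂₁, hA₂₃, hA₃₂, hA₁₃, hA₃₁,
        hA₂₂, hA₃₃, hA, ite_mul]
  have hherd : (∃ u, ∀ r, 0 < (ctrbMat A (Pi.single (Sum.inl ()) 1)).mulVec u r) ↔
      ∃ v ∈ treeSpace A₂₁ s par w, ∀ r, 0 < v r := by
    simp [← range_ctrbMat_eq_treeSpace hs hmul]
  have hfun : (∃ v ∈ treeSpace A₂₁ s par w, ∀ r, 0 < v r) ↔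
      (∃ p : ℝ → ℝ, ∀ i, 0 < p (s i) * A₂₁ i) ∧
        ∃ q : ℝ → ℝ, ∀ k, 0 < q (s (par k)) * (w k * A₂₁ (par k)) := by
    constructor
    · rintro ⟨_, ⟨x, p, q, rfl⟩, hv⟩
      exact ⟨⟨p, fun i => hv (Sum.inr (Sum.inl i))⟩, ⟨q, fun k => hv (Sum.inr (Sum.inr k))⟩⟩
    · rintro ⟨⟨p, hp⟩, ⟨q, hq⟩⟩
      refine ⟨_, ⟨1, p, q, rfl⟩, ?_⟩
      rintro (_ | i | k)
      exacts [one_pos, hp i, hq k]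
  rw [hherd, hfun, exists_fun_mul_pos_iff s A₂₁,
    exists_fun_mul_pos_iff (fun k => s (par k)) fun k => w k * A₂₁ (par k),
    herdable_conditions_iff hw0]
  simp only [eq_zero_or_unisigned_iff, hA, s]
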